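/- arXiv:1402.2365 — 2 statements merged into one kernel-verified Lean document; each statement's English description precedes it below -/
import Mathlib

section
/- Assume additionally that f is convex and argmin_Θ F is nonempty, and let (θ_n) be the perturbed FISTA sequence with γ_n ∈ (0, 1/L] for all n ≥ 1. If lim_n γ_{n+1} t_n² = +∞ and there exists θ⋆ ∈ 𝓛 such that the series Σ_{n≥0} γ_{n+1} t_n ⟨Δ̄_n − θ⋆, η̌_{n+1}⟩ converges in ℝ and Σ_{n≥0} γ_{n+1}² t_n² ‖η̌_{n+1}‖² < ∞, then lim_n F(θ_n) = F(θ⋆) and every limit point of the sequence (θ_n) lies in 𝓛. -/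
open Filter MeasureTheory Finset
open scoped InnerProductSpace Topology

noncomputable section

variable {E : Type*} [NormedAddCommGroup E] [InnerProductSpace ℝ E]

/-- Convexity of an `EReal`-valued function `g` (codomain `(-∞, +∞]`). -/
def ERealConvexOn (g : E → EReal) : Prop :=
  ∀ x y : E, ∀ a b : ℝ, 0 ≤ a → 0 ≤ b → a + b = 1 →
    g (a • x + b • y) ≤ (a : EReal) * g x + (b : EReal) * g y

/-- `p` minimizes `v ↦ g v + ‖v - θ‖² / (2γ)`. -/
def IsProxPt (g : E → EReal) (γ : ℝ) (θ p : E) : Prop :=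
  ∀ v : E, g p + ((‖p - θ‖ ^ 2 / (2 * γ) : ℝ) : EReal)
      ≤ g v + ((‖v - θ‖ ^ 2 / (2 * γ) : ℝ) : EReal)

/-- Subdifferential of an `EReal`-valued convex function at `θ`. -/
def subdiff (g : E → EReal) (θ : E) : Set E :=
  {u : E | ∀ v : E, g θ + ((⟪u, v - θ⟫_ℝ : ℝ) : EReal) ≤ g v}

/-- The set `𝓛 = {θ ∈ Dom g : 0 ∈ ∇f(θ) + ∂g(θ)}`. -/
def statPoints (f' : E → E) (g : E → EReal) : Set E :=
  {θ : E | g θ ≠ ⊤ ∧ -f' θ ∈ subdiff g θ}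

/-- `F = f + g`, with values in `(-∞, +∞]`. -/
def Fval (f : E → ℝ) (g : E → EReal) (θ : E) : EReal := (f θ : EReal) + g θ

/-- The real value of `F = f + g` (used at points of the domain of `g`). -/
def Freal (f : E → ℝ) (g : E → EReal) (θ : E) : ℝ := f θ + (g θ).toReal

/-- The proximal gradient map `T_γ(θ) = Prox_γ(θ - γ ∇f(θ))`. -/
def Tmap (prox : ℝ → E → E) (f' : E → E) (γ : ℝ) (θ : E) : E :=
  prox γ (θ - γ • f' θ)

variable [CompleteSpace E]

/-- Standing assumptions: `g` is convex, lower semicontinuous, proper, with values in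
`(-∞, +∞]`; `f` is differentiable with `L`-Lipschitz gradient `f'`; and `prox γ θ`
is the unique minimizer of `v ↦ g v + ‖v - θ‖²/(2γ)` for every `γ > 0`. -/
structure ProxSetting (f : E → ℝ) (f' : E → E) (g : E → EReal) (L : ℝ)
    (prox : ℝ → E → E) : Prop where
  g_ne_bot : ∀ x, g x ≠ ⊥
  g_ne_top : ∃ x, g x ≠ ⊤
  g_lsc : LowerSemicontinuous g
  g_conv : ERealConvexOn g
  f_grad : ∀ x, HasGradientAt f (f' x) x
  L_pos : 0 < L
  lip : ∀ x y, ‖f' x - f' y‖ ≤ L * ‖x - y‖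
  prox_spec : ∀ γ : ℝ, 0 < γ → ∀ θ, IsProxPt g γ θ (prox γ θ)
  prox_unique : ∀ γ : ℝ, 0 < γ → ∀ θ p, IsProxPt g γ θ p → p = prox γ θ

end

theorem aux_dir {E : Type*} [NormedAddCommGroup E] [InnerProductSpace ℝ E] [CompleteSpace E]
    {h : E → ℝ} {h' p : E} (hh : HasGradientAt h h' p) (d : E) :
    HasDerivAt (fun s : ℝ => h (p + s • d)) ⟪h', d⟫_ℝ 0 := by
  have h1 : HasDerivAt (fun s : ℝ => p + s • d) d 0 := by
    simpa using ((hasDerivAt_id (0:ℝ)).smul_const d).const_add p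
  have h2 : HasFDerivAt h (InnerProductSpace.toDual ℝ E h') (p + (0:ℝ) • d) := by
    simpa using hh.hasFDerivAt
  have h3 := h2.comp_hasDerivAt (0:ℝ) h1
  rw [InnerProductSpace.toDual_apply_apply] at h3
  exact h3

theorem aux_le {E : Type*} [NormedAddCommGroup E] [InnerProductSpace ℝ E] [CompleteSpace E]
    {h : E → ℝ} {h' p : E} (hh : HasGradientAt h h' p) (d : E) (c : ℝ)
    (hc : ∀ s : ℝ, 0 < s → s ≤ 1 → s * c ≤ h (p + s • d) - h p) : c ≤ ⟪h', d⟫_ℝ := by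
  have h1 := (aux_dir hh d).hasDerivWithinAt (s := Set.Ioi 0)
  rw [hasDerivWithinAt_iff_tendsto_slope' (by simp)] at h1
  refine ge_of_tendsto h1 ?_
  have : Set.Ioc (0:ℝ) 1 ∈ 𝓝[>] (0:ℝ) := Ioc_mem_nhdsGT one_pos
  filter_upwards [this] with s hs'
  rw [slope_def_field]
  have := hc s hs'.1 hs'.2
  rw [le_div_iff₀ (by linarith [hs'.1])]
  simp
  linarith

theorem aux_conv {E : Type*} [NormedAddCommGroup E] [InnerProductSpace ℝ E] [CompleteSpace E]
    {f : E → ℝ} {f' : E → E} (hf : ∀ x, HasGradientAt f (f' x) x) (hc : ConvexOn ℝ Set.univ f)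
    (x v : E) : f x + ⟪f' x, v - x⟫_ℝ ≤ f v := by
  have hneg : HasGradientAt (fun y => - f y) (-f' x) x := by
    rw [hasGradientAt_iff_hasFDerivAt, map_neg]
    exact (hf x).hasFDerivAt.neg
  have := aux_le hneg (v - x) (f x - f v) (by
    intro s h0 h1
    have := hc.2 (Set.mem_univ x) (Set.mem_univ v) (by linarith : 0 ≤ 1 - s) h0.le (by ring)
    have e : (1 - s) • x + s • v = x + s • (v - x) := by module
    rw [e] at this
    simp only [smul_eq_mul] at this
    linarith)
  rw [inner_neg_left] at this
  linarith

theorem aux_descent {E : Type*} [NormedAddCommGroup E] [InnerProductSpace ℝ E] [CompleteSpace E]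
    {f : E → ℝ} {f' : E → E} {L : ℝ} (hf : ∀ x, HasGradientAt f (f' x) x)
    (lip : ∀ x y, ‖f' x - f' y‖ ≤ L * ‖x - y‖) (x y : E) :
    f y ≤ f x + ⟪f' x, y - x⟫_ℝ + L / 2 * ‖y - x‖ ^ 2 := by
  set d := y - x with hd
  have hder : ∀ s : ℝ, HasDerivAt (fun s : ℝ => f (x + s • d) - s * ⟪f' x, d⟫_ℝ
      - L / 2 * ‖d‖ ^ 2 * s ^ 2) (⟪f' (x + s • d), d⟫_ℝ - ⟪f' x, d⟫_ℝ - L * ‖d‖ ^ 2 * s) s := by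
    intro s
    have h1 : HasDerivAt (fun r : ℝ => f (x + r • d)) ⟪f' (x + s • d), d⟫_ℝ s := by
      have h1 : HasDerivAt (fun s : ℝ => x + s • d) d s := by
        simpa using ((hasDerivAt_id s).smul_const d).const_add x
      have h3 := (hf (x + s • d)).hasFDerivAt.comp_hasDerivAt s h1
      rw [InnerProductSpace.toDual_apply_apply] at h3
      exact h3
    have h2 := (hasDerivAt_id s).mul_const ⟪f' x, d⟫_ℝ
    have h3 := ((hasDerivAt_id s).pow 2).const_mul (L / 2 * ‖d‖ ^ 2)
    refine ((h1.sub h2).sub h3).congr_deriv ?_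
    simp; ring
  have hanti := antitoneOn_of_deriv_nonpos (convex_Icc (0:ℝ) 1)
    (fun s _ => (hder s).continuousAt.continuousWithinAt)
    (fun s _ => (hder s).differentiableAt.differentiableWithinAt)
    (by
      intro s hs'
      rw [interior_Icc] at hs'
      rw [(hder s).deriv, ← inner_sub_left]
      have h1 := real_inner_le_norm (f' (x + s • d) - f' x) d
      have h2 := lip (x + s • d) x
      rw [add_sub_cancel_left, norm_smul, Real.norm_of_nonneg hs'.1.le] at h2
      nlinarith [norm_nonneg d, mul_le_mul_of_nonneg_right h2 (norm_nonneg d)])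
  have := hanti (show (0:ℝ) ∈ Set.Icc 0 1 by simp) (show (1:ℝ) ∈ Set.Icc 0 1 by simp) zero_le_one
  simp [hd] at this
  rw [hd]
  linarith

theorem aux_opt {E : Type*} [NormedAddCommGroup E] [InnerProductSpace ℝ E] [CompleteSpace E]
    {g : E → EReal} (hbot : ∀ x, g x ≠ ⊥) (hconv : ERealConvexOn g)
    {h : E → ℝ} {h' p : E} (hh : HasGradientAt h h' p) (hp : g p ≠ ⊤)
    (hmin : ∀ v, g p + (h p : EReal) ≤ g v + (h v : EReal)) (v : E) (hv : g v ≠ ⊤) :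
    (g p).toReal + ⟪-h', v - p⟫_ℝ ≤ (g v).toReal := by
  have := aux_le hh (v - p) ((g p).toReal - (g v).toReal) (by
    intro s h0 h1
    have h2 := hconv p v (1 - s) s (by linarith) h0.le (by ring)
    have e : (1 - s) • p + s • v = p + s • (v - p) := by module
    rw [e] at h2
    have h3 := hmin (p + s • (v - p))
    have h4 := h3.trans (add_le_add_left h2 _)
    rw [← EReal.coe_toReal hp (hbot p), ← EReal.coe_toReal hv (hbot v)] at h4
    norm_cast at h4
    linarith)
  rw [inner_neg_left]
  linarith

theorem aux_stat {E : Type*} [NormedAddCommGroup E] [InnerProductSpace ℝ E] [CompleteSpace E]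
    {f : E → ℝ} {f' : E → E} {g : E → EReal} {L : ℝ} {prox : ℝ → E → E}
    (hs : ProxSetting f f' g L prox) (x : E) (hx : g x ≠ ⊤)
    (hmin : ∀ v, Fval f g x ≤ Fval f g v) : x ∈ statPoints f' g := by
  refine ⟨hx, fun v => ?_⟩
  by_cases hv : g v = ⊤
  · rw [hv]; exact le_top
  have := aux_opt hs.g_ne_bot hs.g_conv (hs.f_grad x) hx
    (fun v => by simpa [Fval, add_comm] using hmin v) v hv
  rw [← EReal.coe_toReal hx (hs.g_ne_bot x), ← EReal.coe_toReal hv (hs.g_ne_bot v)]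
  exact_mod_cast this

theorem aux_prox {E : Type*} [NormedAddCommGroup E] [InnerProductSpace ℝ E] [CompleteSpace E]
    {f : E → ℝ} {f' : E → E} {g : E → EReal} {L : ℝ} {prox : ℝ → E → E}
    (hs : ProxSetting f f' g L prox) {γ : ℝ} (hγ : 0 < γ) (z : E) :
    g (prox γ z) ≠ ⊤ ∧ ∀ v, g v ≠ ⊤ →
      γ * ((g (prox γ z)).toReal - (g v).toReal) ≤ ⟪z - prox γ z, prox γ z - v⟫_ℝ := by
  set p := prox γ z with hpdef
  have hspec := hs.prox_spec γ hγ z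
  rw [← hpdef] at hspec
  have hp : g p ≠ ⊤ := by
    intro h
    obtain ⟨x, hx⟩ := hs.g_ne_top
    have := hspec x
    rw [h, EReal.top_add_coe, top_le_iff] at this
    rw [← EReal.coe_toReal hx (hs.g_ne_bot x)] at this
    exact EReal.coe_ne_top _ (by exact_mod_cast this)
  refine ⟨hp, fun v hv => ?_⟩
  have hgrad : HasGradientAt (fun v : E => ‖v - z‖ ^ 2 / (2 * γ)) (γ⁻¹ • (p - z)) p := by
    rw [hasGradientAt_iff_hasFDerivAt]
    have h1 := (((hasFDerivAt_id (𝕜 := ℝ) p).sub_const z).norm_sq).mul_const ((2 * γ)⁻¹)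
    refine (h1.congr_fderiv ?_).congr_of_eventuallyEq ?_
    · ext y
      simp
      field_simp
    · exact Eventually.of_forall fun y => by simp [div_eq_mul_inv]
  have := aux_opt hs.g_ne_bot hs.g_conv hgrad hp hspec v hv
  have e : ⟪-(γ⁻¹ • (p - z)), v - p⟫_ℝ = - (γ⁻¹ * ⟪z - p, p - v⟫_ℝ) := by
    rw [← smul_neg, neg_sub, real_inner_smul_left, ← neg_sub p v, inner_neg_right]; ring
  rw [e] at this
  have h2 : (g p).toReal - (g v).toReal ≤ γ⁻¹ * ⟪z - p, p - v⟫_ℝ := by linarith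
  have h3 := mul_le_mul_of_nonneg_left h2 hγ.le
  rwa [mul_inv_cancel_left₀ hγ.ne'] at h3

theorem aux_nonexp {E : Type*} [NormedAddCommGroup E] [InnerProductSpace ℝ E] [CompleteSpace E]
    {f : E → ℝ} {f' : E → E} {g : E → EReal} {L : ℝ} {prox : ℝ → E → E}
    (hs : ProxSetting f f' g L prox) {γ : ℝ} (hγ : 0 < γ) (z w : E) :
    ‖prox γ z - prox γ w‖ ≤ ‖z - w‖ := by
  obtain ⟨h1, h2⟩ := aux_prox hs hγ z
  obtain ⟨h3, h4⟩ := aux_prox hs hγ w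
  have h5 := h2 _ h3
  have h6 := h4 _ h1
  set p := prox γ z
  set q := prox γ w
  have e : ⟪z - p, p - q⟫_ℝ + ⟪w - q, q - p⟫_ℝ = ⟪z - w, p - q⟫_ℝ - ‖p - q‖ ^ 2 := by
    rw [← real_inner_self_eq_norm_sq, ← neg_sub p q, inner_neg_right, ← sub_eq_add_neg,
      ← inner_sub_left, ← inner_sub_left]
    congr 1; abel
  have h7 := real_inner_le_norm (z - w) (p - q)
  have h8 : ‖p - q‖ ^ 2 ≤ ‖z - w‖ * ‖p - q‖ := by linarith
  by_contra! h
  nlinarith [norm_nonneg (z - w), norm_nonneg (p - q)]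

theorem aux_step {E : Type*} [NormedAddCommGroup E] [InnerProductSpace ℝ E] [CompleteSpace E]
    {f : E → ℝ} {f' : E → E} {g : E → EReal} {L : ℝ} {prox : ℝ → E → E}
    (hs : ProxSetting f f' g L prox) (hc : ConvexOn ℝ Set.univ f) {γ : ℝ} (hγ : 0 < γ)
    (hγL : γ ≤ 1 / L) (x η p : E) (hp : p = prox γ (x - γ • (η + f' x))) (v : E) (hv : g v ≠ ⊤) :
    γ * (Freal f g p - Freal f g v) ≤
      1 / 2 * (‖v - x‖ ^ 2 - ‖v - p‖ ^ 2) - γ * ⟪p - v, η⟫_ℝ := by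
  have h1 := (aux_prox hs hγ (x - γ • (η + f' x))).2 v hv
  rw [← hp] at h1
  have h2 := aux_descent hs.f_grad hs.lip x p
  have h3 := aux_conv hs.f_grad hc x v
  have hL : γ * L ≤ 1 := by
    rw [le_div_iff₀ hs.L_pos] at hγL; exact hγL
  have h4 : γ * (f p - f v) ≤ γ * ⟪f' x, p - v⟫_ℝ + 1 / 2 * ‖p - x‖ ^ 2 := by
    have e : ⟪f' x, p - v⟫_ℝ = ⟪f' x, p - x⟫_ℝ - ⟪f' x, v - x⟫_ℝ := by
      rw [← inner_sub_right]; congr 1; abel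
    have : f p - f v ≤ ⟪f' x, p - v⟫_ℝ + L / 2 * ‖p - x‖ ^ 2 := by linarith
    have := mul_le_mul_of_nonneg_left this hγ.le
    nlinarith [sq_nonneg ‖p - x‖]
  have e1 : ⟪x - γ • (η + f' x) - p, p - v⟫_ℝ =
      ⟪x - p, p - v⟫_ℝ - γ * ⟪p - v, η⟫_ℝ - γ * ⟪f' x, p - v⟫_ℝ := by
    rw [real_inner_comm η (p - v)]
    have : x - γ • (η + f' x) - p = (x - p) - γ • η - γ • f' x := by module
    rw [this, inner_sub_left, inner_sub_left, real_inner_smul_left, real_inner_smul_left]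
  have e2 : ⟪x - p, p - v⟫_ℝ = 1 / 2 * (‖v - x‖ ^ 2 - ‖v - p‖ ^ 2) - 1 / 2 * ‖p - x‖ ^ 2 := by
    have : v - x = -((x - p) + (p - v)) := by abel
    rw [this, norm_neg, norm_add_sq_real, norm_sub_rev v p, norm_sub_rev p x]; ring
  rw [e1, e2] at h1
  unfold Freal
  linarith

theorem aux_id {E : Type*} [NormedAddCommGroup E] [InnerProductSpace ℝ E] (t : ℝ) (x a s : E) :
    ‖t • x - (t - 1) • a - s‖ ^ 2 =
      t * (t - 1) * ‖a - x‖ ^ 2 + t * ‖s - x‖ ^ 2 - (t - 1) * ‖s - a‖ ^ 2 := by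
  have e1 : t • x - (t - 1) • a - s = (t - 1) • (x - a) + (x - s) := by module
  have e2 : s - a = (x - a) - (x - s) := by abel
  rw [e1, e2, norm_add_sq_real, norm_sub_sq_real (x - a) (x - s), norm_smul, mul_pow, real_inner_smul_left,
    norm_sub_rev a x, norm_sub_rev s x, Real.norm_eq_abs, sq_abs]
  ring

theorem aux_main {E : Type*} [NormedAddCommGroup E] [InnerProductSpace ℝ E] [CompleteSpace E]
    {f : E → ℝ} {f' : E → E} {g : E → EReal} {L : ℝ} {prox : ℝ → E → E}
    (hs : ProxSetting f f' g L prox) (hc : ConvexOn ℝ Set.univ f) {γ : ℝ} (hγ : 0 < γ)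
    (hγL : γ ≤ 1 / L) (x η p : E) (hp : p = prox γ (x - γ • (η + f' x))) (a s : E)
    (ha : g a ≠ ⊤) (hsd : g s ≠ ⊤) (t : ℝ) (ht : 1 ≤ t) :
    γ * t ^ 2 * (Freal f g p - Freal f g s) + 1 / 2 * ‖t • p - (t - 1) • a - s‖ ^ 2 ≤
      γ * t * (t - 1) * (Freal f g a - Freal f g s) + 1 / 2 * ‖t • x - (t - 1) • a - s‖ ^ 2
      + (γ ^ 2 * t ^ 2 * ‖η‖ ^ 2
        - γ * t * ⟪(1 - t) • a + t • Tmap prox f' γ x - s, η⟫_ℝ) := by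
  have h1 := aux_step hs hc hγ hγL x η p hp a ha
  have h2 := aux_step hs hc hγ hγL x η p hp s hsd
  have h1' := mul_le_mul_of_nonneg_left h1 (by nlinarith : 0 ≤ t * (t - 1))
  have h2' := mul_le_mul_of_nonneg_left h2 (by linarith : 0 ≤ t)
  have hne : ‖Tmap prox f' γ x - p‖ ≤ γ * ‖η‖ := by
    rw [hp]
    refine (aux_nonexp hs hγ _ _).trans (le_of_eq ?_)
    have : x - γ • f' x - (x - γ • (η + f' x)) = γ • η := by module
    rw [this, norm_smul, Real.norm_of_nonneg hγ.le]
  have e : ⟪(1 - t) • a + t • Tmap prox f' γ x - s, η⟫_ℝ =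
      t * ⟪Tmap prox f' γ x - p, η⟫_ℝ + (t - 1) * ⟪p - a, η⟫_ℝ + ⟪p - s, η⟫_ℝ := by
    rw [← real_inner_smul_left, ← real_inner_smul_left, ← inner_add_left, ← inner_add_left]
    congr 1; module
  have h3 : ⟪Tmap prox f' γ x - p, η⟫_ℝ ≤ γ * ‖η‖ ^ 2 := by
    have := real_inner_le_norm (Tmap prox f' γ x - p) η
    nlinarith [norm_nonneg η]
  have h3' := mul_le_mul_of_nonneg_left h3 (by positivity : 0 ≤ γ * t ^ 2)
  rw [e, aux_id, aux_id]
  linarith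


/-- **Theorem 3.6 (i)** (convergence of perturbed FISTA). -/
theorem stmt8
    {E : Type*} [NormedAddCommGroup E] [InnerProductSpace ℝ E] [FiniteDimensional ℝ E]
    (f : E → ℝ) (f' : E → E) (g : E → EReal) (L : ℝ) (prox : ℝ → E → E)
    (hs : ProxSetting f f' g L prox)
    (hfconv : ConvexOn ℝ Set.univ f)
    (hargmin : ∃ m : E, ∀ v : E, Fval f g m ≤ Fval f g v)
    (t : ℕ → ℝ) (ht : ∀ n, 0 < t n) (ht0 : t 0 = 1)
    (γ : ℕ → ℝ) (hγ : ∀ n : ℕ, 1 ≤ n → 0 < γ n ∧ γ n ≤ 1 / L)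
    (hseq : ∀ n : ℕ, 1 ≤ n → γ (n + 1) * t n * (t n - 1) ≤ γ n * t (n - 1) ^ 2)
    (θ ϑ H : ℕ → E) (hθ0 : g (θ 0) ≠ ⊤) (hϑ0 : ϑ 0 = θ 0)
    (hθ1 : θ 1 = prox (γ 1) (θ 0 - γ 1 • H 1))
    (hϑ : ∀ n : ℕ, 1 ≤ n → ϑ n = θ n + ((t (n - 1) - 1) / t n) • (θ n - θ (n - 1)))
    (hθrec : ∀ n : ℕ, 1 ≤ n → θ (n + 1) = prox (γ (n + 1)) (ϑ n - γ (n + 1) • H (n + 1)))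
    (ηc : ℕ → E) (hηc : ∀ n : ℕ, ηc (n + 1) = H (n + 1) - f' (ϑ n))
    (htγ : Tendsto (fun n => γ (n + 1) * t n ^ 2) atTop atTop)
    (θs : E) (hθs : θs ∈ statPoints f' g)
    (hser : ∃ s : ℝ,
      Tendsto
        (fun N => ∑ k ∈ Finset.range N,
          γ (k + 1) * t k *
            ⟪(1 - t k) • θ k + t k • Tmap prox f' (γ (k + 1)) (ϑ k) - θs, ηc (k + 1)⟫_ℝ)
        atTop (nhds s))
    (hsq : Summable fun n => γ (n + 1) ^ 2 * t n ^ 2 * ‖ηc (n + 1)‖ ^ 2) :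
    Tendsto (fun n => Fval f g (θ n)) atTop (nhds (Fval f g θs)) ∧
      ∀ x : E, MapClusterPt x atTop θ → x ∈ statPoints f' g := by
  have hminF : ∀ v, Fval f g θs ≤ Fval f g v := by
    intro v
    have h1 := hθs.2 v
    have h2 := aux_conv hs.f_grad hfconv θs v
    unfold Fval
    by_cases hv : g v = ⊤
    · rw [hv]; simp
    rw [← EReal.coe_toReal hθs.1 (hs.g_ne_bot θs), ← EReal.coe_toReal hv (hs.g_ne_bot v)] at h1 ⊢
    norm_cast at h1 ⊢
    rw [inner_neg_left] at h1
    linarith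
  have hF : ∀ x, g x ≠ ⊤ → Fval f g x = ((Freal f g x : ℝ) : EReal) := by
    intro x hx
    unfold Fval Freal
    rw [EReal.coe_add, EReal.coe_toReal hx (hs.g_ne_bot x)]
  have hrec : ∀ n, θ (n + 1) = prox (γ (n + 1)) (ϑ n - γ (n + 1) • (ηc (n + 1) + f' (ϑ n))) := by
    intro n
    rw [hηc, sub_add_cancel]
    rcases Nat.eq_zero_or_pos n with rfl | hn
    · rw [hϑ0]; exact hθ1
    · exact hθrec n hn
  have hγ' : ∀ n, 0 < γ (n + 1) ∧ γ (n + 1) ≤ 1 / L := fun n => hγ _ (by omega)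
  have hdom : ∀ n, g (θ n) ≠ ⊤ := by
    intro n
    rcases n with _ | n
    · exact hθ0
    · rw [hrec n]; exact (aux_prox hs (hγ' n).1 _).1
  set W : ℕ → ℝ := fun n => Freal f g (θ n) - Freal f g θs with hW
  have hW0 : ∀ n, 0 ≤ W n := by
    intro n
    have := hminF (θ n)
    rw [hF _ hθs.1, hF _ (hdom n)] at this
    have := EReal.coe_le_coe_iff.1 this
    simp only [hW]; linarith
  -- eventually t ≥ 1
  have htev : ∀ᶠ n in atTop, 1 ≤ t n := by
    filter_upwards [htγ.eventually_ge_atTop (1 / L)] with n hn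
    by_contra! h
    have := (hγ' n).2
    have h0 := ht n
    have : t n ^ 2 < 1 := by nlinarith
    nlinarith [(hγ' n).1]
  obtain ⟨N, hN⟩ := eventually_atTop.1 htev
  set U : ℕ → E := fun n => t n • θ (n + 1) - (t n - 1) • θ n - θs with hU
  set V : ℕ → ℝ := fun n => γ (n + 1) * t n ^ 2 * W (n + 1) + 1 / 2 * ‖U n‖ ^ 2 with hV
  set b : ℕ → ℝ := fun k => γ (k + 1) ^ 2 * t k ^ 2 * ‖ηc (k + 1)‖ ^ 2 - γ (k + 1) * t k *
            ⟪(1 - t k) • θ k + t k • Tmap prox f' (γ (k + 1)) (ϑ k) - θs, ηc (k + 1)⟫_ℝ with hb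
  have hstep : ∀ n, N ≤ n → V (n + 1) ≤ V n + b (n + 1) := by
    intro n hn
    have h1 := aux_main hs hfconv (hγ' (n + 1)).1 (hγ' (n + 1)).2 (ϑ (n + 1)) (ηc (n + 1 + 1))
      (θ (n + 1 + 1)) (hrec (n + 1)) (θ (n + 1)) θs (hdom _) hθs.1 (t (n + 1)) (hN _ (by omega))
    have h2 := hseq (n + 1) (by omega)
    have h3 := hϑ (n + 1) (by omega)
    simp only [Nat.add_sub_cancel] at h2 h3
    have e : t (n + 1) • ϑ (n + 1) - (t (n + 1) - 1) • θ (n + 1) - θs = U n := by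
      rw [h3, smul_add, smul_smul, mul_div_cancel₀ _ (ht _).ne']
      simp only [hU]; module
    rw [e] at h1
    have h4 := mul_le_mul_of_nonneg_right h2 (hW0 (n + 1))
    simp only [hV, hU, hb, hW] at *
    linarith
  obtain ⟨s, hser⟩ := hser
  have hB : Tendsto (fun n => ∑ k ∈ Finset.range n, b k) atTop (𝓝 ((∑' n, γ (n + 1) ^ 2 * t n ^ 2 * ‖ηc (n + 1)‖ ^ 2) - s)) := by
    simp only [hb, Finset.sum_sub_distrib]
    exact hsq.hasSum.tendsto_sum_nat.sub hser
  obtain ⟨C, hC⟩ := hB.bddAbove_range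
  have hVb : ∀ n, N ≤ n → V n ≤ V N - ∑ k ∈ Finset.range (N + 1), b k
      + ∑ k ∈ Finset.range (n + 1), b k := by
    intro n hn
    induction n, hn using Nat.le_induction with
    | base => linarith
    | succ n hn ih =>
      rw [Finset.sum_range_succ _ (n + 1)]
      linarith [hstep n hn]
  set D := V N - ∑ k ∈ Finset.range (N + 1), b k + C with hD
  have hWt : Tendsto (fun n => W (n + 1)) atTop (𝓝 0) := by
    refine squeeze_zero' (Eventually.of_forall fun n => hW0 _) ?_ (htγ.const_div_atTop D)
    filter_upwards [eventually_ge_atTop N] with n hn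
    have h0 : 0 < γ (n + 1) * t n ^ 2 := mul_pos (hγ' n).1 (pow_pos (ht n) 2)
    rw [le_div_iff₀ h0]
    have h1 := hVb n hn
    have h2 : ∑ k ∈ Finset.range (n + 1), b k ≤ C := hC ⟨n + 1, rfl⟩
    have h3 : γ (n + 1) * t n ^ 2 * W (n + 1) + 1 / 2 * ‖U n‖ ^ 2 ≤ D := by
      change V n ≤ D
      linarith
    nlinarith [sq_nonneg ‖U n‖]
  have hWt' : Tendsto W atTop (𝓝 0) := (tendsto_add_atTop_iff_nat 1).1 hWt
  have hconv : Tendsto (fun n => Fval f g (θ n)) atTop (nhds (Fval f g θs)) := by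
    have : (fun n => Fval f g (θ n)) = fun n => ((Freal f g (θ n) : ℝ) : EReal) :=
      funext fun n => hF _ (hdom n)
    rw [this, hF _ hθs.1]
    refine EReal.tendsto_coe.2 ?_
    simpa [hW] using hWt'.add_const (Freal f g θs)
  refine ⟨hconv, fun x hx => ?_⟩
  have hle : Fval f g x ≤ Fval f g θs := by
    have hlsc : LowerSemicontinuous (fun y => Fval f g y) := by
      have hfc : Continuous f :=
        continuous_iff_continuousAt.2 fun y => (hs.f_grad y).hasFDerivAt.continuousAt
      refine LowerSemicontinuous.add' 
        (continuous_coe_real_ereal.comp hfc).lowerSemicontinuous hs.g_lsc fun y => ?_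
      exact EReal.continuousAt_add (by simp) (by simp)
    by_contra! h
    obtain ⟨c, hc1, hc2⟩ := exists_between h
    have h1 := hx.frequently (hlsc x c hc2)
    have h2 := hconv.eventually (gt_mem_nhds hc1)
    obtain ⟨n, hn1, hn2⟩ := (h1.and_eventually h2).exists
    exact lt_asymm hn1 hn2
  refine aux_stat hs x ?_ fun v => hle.trans (hminF v)
  intro hxt
  rw [hF _ hθs.1] at hle
  unfold Fval at hle
  rw [hxt, EReal.coe_add_top, top_le_iff] at hle
  exact EReal.coe_ne_top _ hle
end

section
/- Let γ ∈ (0, 1/L]. Then for all θ, ϑ ∈ Θ: −2γ (F(Prox_γ(θ)) − F(ϑ)) ≥ ‖Prox_γ(θ) − ϑ‖² + 2 ⟨Prox_γ(θ) − ϑ, ϑ − γ∇f(ϑ) − θ⟩, as an inequality in (−∞, +∞] (the left-hand side being +∞ when F(ϑ) = +∞). -/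
open Filter MeasureTheory Finset
open scoped InnerProductSpace Topology

theorem descent_aux {E : Type*} [NormedAddCommGroup E] [InnerProductSpace ℝ E] [CompleteSpace E]
    (f : E → ℝ) (f' : E → E) (L : ℝ) (hf : ∀ x, HasGradientAt f (f' x) x)
    (lip : ∀ x y, ‖f' x - f' y‖ ≤ L * ‖x - y‖) (x d : E) :
    f (x + d) ≤ f x + ⟪f' x, d⟫_ℝ + L / 2 * ‖d‖ ^ 2 := by
  have hd : ∀ t : ℝ, HasDerivAt
      (fun t : ℝ => f (x + t • d) - t * ⟪f' x, d⟫_ℝ - L / 2 * ‖d‖ ^ 2 * t ^ 2)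
      (⟪f' (x + t • d), d⟫_ℝ - ⟪f' x, d⟫_ℝ - L / 2 * ‖d‖ ^ 2 * (2 * t)) t := by
    intro t
    have h1 : HasDerivAt (fun t : ℝ => x + t • d) d t := by
      simpa using ((hasDerivAt_id t).smul_const d).const_add x
    have h2 : HasDerivAt (fun t : ℝ => f (x + t • d)) (⟪f' (x + t • d), d⟫_ℝ) t := by
      have := (hf (x + t • d)).hasFDerivAt.comp_hasDerivAt t h1
      simp at this
      exact this
    have h3 : HasDerivAt (fun t : ℝ => t * ⟪f' x, d⟫_ℝ) (⟪f' x, d⟫_ℝ) t := by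
      simpa using (hasDerivAt_id t).mul_const (⟪f' x, d⟫_ℝ)
    have h4 : HasDerivAt (fun t : ℝ => L / 2 * ‖d‖ ^ 2 * t ^ 2) (L / 2 * ‖d‖ ^ 2 * (2 * t)) t := by
      simpa using (hasDerivAt_pow 2 t).const_mul (L / 2 * ‖d‖ ^ 2)
    exact (h2.sub h3).sub h4
  have ha := antitoneOn_of_deriv_nonpos (convex_Icc (0 : ℝ) 1)
    (fun t _ => (hd t).continuousAt.continuousWithinAt)
    (fun t _ => (hd t).differentiableAt.differentiableWithinAt)
    (by
      intro t ht
      rw [interior_Icc] at ht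
      rw [(hd t).deriv, ← inner_sub_left]
      have h1 := real_inner_le_norm (f' (x + t • d) - f' x) d
      have h2 := lip (x + t • d) x
      rw [add_sub_cancel_left, norm_smul, Real.norm_of_nonneg ht.1.le] at h2
      have h3 := mul_le_mul_of_nonneg_right h2 (norm_nonneg d)
      nlinarith)
  have := ha (show (0 : ℝ) ∈ Set.Icc (0 : ℝ) 1 by simp) (show (1 : ℝ) ∈ Set.Icc (0 : ℝ) 1 by simp)
    zero_le_one
  simp at this
  linarith

theorem lim_aux (A B : ℝ) (hB : 0 ≤ B) (h : ∀ t : ℝ, 0 < t → t ≤ 1 → A ≤ t * B) : A ≤ 0 := by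
  by_contra! hA
  have hs : 0 < A + B := by linarith
  have := h (A / (A + B)) (by positivity) (by rw [div_le_one hs]; linarith)
  rw [div_mul_eq_mul_div, le_div_iff₀ hs] at this
  nlinarith

theorem prox_aux {E : Type*} [NormedAddCommGroup E] [InnerProductSpace ℝ E]
    (g : E → EReal) (hc : ERealConvexOn g) (γ : ℝ) (hγ : 0 < γ) (θ p v : E)
    (hp : IsProxPt g γ θ p) (a b : ℝ) (ha : g p = a) (hb : g v = b) :
    2 * γ * (a - b) ≤ 2 * ⟪p - θ, v - p⟫_ℝ := by
  have key : ∀ t : ℝ, 0 < t → t ≤ 1 →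
      2 * γ * (a - b) - 2 * ⟪p - θ, v - p⟫_ℝ ≤ t * ‖v - p‖ ^ 2 := by
    intro t h0 h1
    have h2 := hc p v (1 - t) t (by linarith) h0.le (by ring)
    have h3 := (hp ((1 - t) • p + t • v)).trans (add_le_add_left h2 _)
    rw [ha, hb] at h3
    norm_cast at h3
    have e : (1 - t) • p + t • v - θ = (p - θ) + t • (v - p) := by module
    rw [e, norm_add_sq_real, norm_smul, inner_smul_right, Real.norm_of_nonneg h0.le] at h3
    have h4 := mul_le_mul_of_nonneg_left h3 (show 0 ≤ 2 * γ by linarith)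
    have e1 : ∀ X : ℝ, 2 * γ * (X / (2 * γ)) = X := fun X => by field_simp
    rw [mul_add, mul_add, e1, e1] at h4
    refine le_of_mul_le_mul_left ?_ h0
    nlinarith
  have := lim_aux _ _ (by positivity) key
  linarith

/-- **Lemma 6.2, Eq. (6.2)**. -/
theorem stmt13
    {E : Type*} [NormedAddCommGroup E] [InnerProductSpace ℝ E] [FiniteDimensional ℝ E]
    (f : E → ℝ) (f' : E → E) (g : E → EReal) (L : ℝ) (prox : ℝ → E → E)
    (hs : ProxSetting f f' g L prox)
    (γ : ℝ) (hγ0 : 0 < γ) (hγL : γ ≤ 1 / L) :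
    ∀ θ ϑ : E,
      ((‖prox γ θ - ϑ‖ ^ 2 + 2 * ⟪prox γ θ - ϑ, ϑ - γ • f' ϑ - θ⟫_ℝ : ℝ) : EReal) ≤
        ((-2 * γ : ℝ) : EReal) * (Fval f g (prox γ θ) - Fval f g ϑ) := by
  intro θ ϑ
  have hp := hs.prox_spec γ hγ0 θ
  set p := prox γ θ with hpdef
  have hpt : g p ≠ ⊤ := by
    intro h
    obtain ⟨x, hx⟩ := hs.g_ne_top
    have h1 := hp x
    rw [h, EReal.top_add_coe, ← EReal.coe_toReal hx (hs.g_ne_bot x)] at h1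
    norm_cast at h1
  obtain ⟨a, ha⟩ : ∃ a : ℝ, g p = a := ⟨_, (EReal.coe_toReal hpt (hs.g_ne_bot p)).symm⟩
  by_cases hv : g ϑ = ⊤
  · have : Fval f g p - Fval f g ϑ = ⊥ := by
      simp [Fval, hv, ha]
    rw [this, EReal.coe_mul_bot_of_neg (by linarith)]
    exact le_top
  obtain ⟨b, hb⟩ : ∃ b : ℝ, g ϑ = b := ⟨_, (EReal.coe_toReal hv (hs.g_ne_bot ϑ)).symm⟩
  have h1 := prox_aux g hs.g_conv γ hγ0 θ p ϑ hp a b ha hb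
  have h2 := descent_aux f f' L hs.f_grad hs.lip ϑ (p - ϑ)
  rw [add_sub_cancel] at h2
  have hL : γ * L ≤ 1 := (le_div_iff₀ hs.L_pos).mp hγL
  have h3 := mul_le_mul_of_nonneg_right hL (sq_nonneg ‖p - ϑ‖)
  have h4 := mul_le_mul_of_nonneg_left h2 (show 0 ≤ 2 * γ by linarith)
  simp only [Fval]
  rw [ha, hb]
  norm_cast
  have e1 : ⟪p - ϑ, ϑ - γ • f' ϑ - θ⟫_ℝ =
      ⟪p - θ, p - ϑ⟫_ℝ - ‖p - ϑ‖ ^ 2 - γ * ⟪f' ϑ, p - ϑ⟫_ℝ := by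
    have : ϑ - γ • f' ϑ - θ = (p - θ) - (p - ϑ) - γ • f' ϑ := by abel
    rw [this, inner_sub_right, inner_sub_right, inner_smul_right, real_inner_self_eq_norm_sq,
      real_inner_comm, real_inner_comm (f' ϑ)]
  have e2 : ⟪p - θ, ϑ - p⟫_ℝ = - ⟪p - θ, p - ϑ⟫_ℝ := by
    rw [← inner_neg_right, neg_sub]
  rw [e2] at h1
  rw [e1]
  push_cast
  nlinarith
end
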